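/- For all m ≥ 0 and pairwise distinct general atoms P, Q, T, R₁,…,R_m, the formula (P → (Q → T)) ∧ (R₁∧…∧R_m → Q) → (P → (R₁∧…∧R_m → T)) is provable in CL2. -/

import Mathlib

/-- CL2-formulas: logical atoms ⊤/⊥, elementary atoms, general atoms,
negation, n-ary ∧, ∨, ⊓, ⊔ (arities other than ≥2 never arise in derivations
of proper formulas). -/
inductive CL2 : Type where
  | top : CL2
  | bot : CL2
  | elem : Nat → CL2
  | gen : Nat → CL2
  | neg : CL2 → CL2
  | land : List CL2 → CL2
  | lor : List CL2 → CL2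
  | chand : List CL2 → CL2
  | chor : List CL2 → CL2

namespace CL2

/-- Elementarization (with a polarity parameter): surface ⊓ becomes ⊤, surface ⊔
becomes ⊥, positive surface general atoms become ⊥, negative ones ⊤. -/
def elz (pos : Bool) : CL2 → CL2
  | top => top
  | bot => bot
  | elem n => elem n
  | gen _ => if pos then bot else top
  | neg F => neg (elz (!pos) F)
  | land l => land (l.attach.map (fun x => elz pos x.1))
  | lor l => lor (l.attach.map (fun x => elz pos x.1))
  | chand _ => top
  | chor _ => bot
termination_by F => sizeOf F
decreasing_by
  all_goals simp_wf
  all_goals first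
    | omega
    | (have h := List.sizeOf_lt_of_mem x.2; omega)

/-- Classical evaluation (used on elementarizations, which contain no
general atoms and no ⊓/⊔). -/
def eval (v : Nat → Bool) : CL2 → Bool
  | top => true
  | bot => false
  | elem n => v n
  | gen _ => false
  | neg F => !(eval v F)
  | land l => (l.attach.map (fun x => eval v x.1)).all id
  | lor l => (l.attach.map (fun x => eval v x.1)).any id
  | chand _ => true
  | chor _ => false
termination_by F => sizeOf F
decreasing_by
  all_goals simp_wf
  all_goals first
    | omega
    | (have h := List.sizeOf_lt_of_mem x.2; omega)

/-- F is stable iff its elementarization is a classical tautology. -/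
def Stable (F : CL2) : Prop := ∀ v : Nat → Bool, eval v (elz true F) = true

/-- Whether the elementary atom `p` occurs (anywhere) in a formula. -/
def elemOccurs (p : Nat) : CL2 → Bool
  | top => false
  | bot => false
  | elem n => n == p
  | gen _ => false
  | neg F => elemOccurs p F
  | land l => (l.attach.map (fun x => elemOccurs p x.1)).any id
  | lor l => (l.attach.map (fun x => elemOccurs p x.1)).any id
  | chand l => (l.attach.map (fun x => elemOccurs p x.1)).any id
  | chor l => (l.attach.map (fun x => elemOccurs p x.1)).any id
termination_by F => sizeOf F
decreasing_by
  all_goals simp_wf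
  all_goals first
    | omega
    | (have h := List.sizeOf_lt_of_mem x.2; omega)

end CL2

/-- One-hole surface contexts: the hole is not in the scope of ⊓ or ⊔. -/
inductive SCtx : Type where
  | hole : SCtx
  | neg : SCtx → SCtx
  | land : List CL2 → SCtx → List CL2 → SCtx
  | lor : List CL2 → SCtx → List CL2 → SCtx

namespace SCtx

def fill : SCtx → CL2 → CL2
  | hole, F => F
  | neg C, F => CL2.neg (fill C F)
  | land l C r, F => CL2.land (l ++ fill C F :: r)
  | lor l C r, F => CL2.lor (l ++ fill C F :: r)

/-- Number of negations the hole is in the scope of. -/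
def negCount : SCtx → Nat
  | hole => 0
  | neg C => negCount C + 1
  | land _ C _ => negCount C
  | lor _ C _ => negCount C

end SCtx

/-- Two-hole surface contexts (the two holes are distinct surface occurrences,
so their least common ancestor is an ∧- or ∨-node). -/
inductive DCtx : Type where
  | neg : DCtx → DCtx
  | land : List CL2 → DCtx → List CL2 → DCtx
  | lor : List CL2 → DCtx → List CL2 → DCtx
  | landS : List CL2 → SCtx → List CL2 → SCtx → List CL2 → DCtx
  | lorS : List CL2 → SCtx → List CL2 → SCtx → List CL2 → DCtx

namespace DCtx

def fill2 : DCtx → CL2 → CL2 → CL2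
  | neg D, A, B => CL2.neg (fill2 D A B)
  | land l D r, A, B => CL2.land (l ++ fill2 D A B :: r)
  | lor l D r, A, B => CL2.lor (l ++ fill2 D A B :: r)
  | landS l C1 m C2 r, A, B => CL2.land (l ++ C1.fill A :: m ++ C2.fill B :: r)
  | lorS l C1 m C2 r, A, B => CL2.lor (l ++ C1.fill A :: m ++ C2.fill B :: r)

def negCount1 : DCtx → Nat
  | neg D => negCount1 D + 1
  | land _ D _ => negCount1 D
  | lor _ D _ => negCount1 D
  | landS _ C1 _ _ _ => C1.negCount
  | lorS _ C1 _ _ _ => C1.negCount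

def negCount2 : DCtx → Nat
  | neg D => negCount2 D + 1
  | land _ D _ => negCount2 D
  | lor _ D _ => negCount2 D
  | landS _ _ _ C2 _ => C2.negCount
  | lorS _ _ _ C2 _ => C2.negCount

end DCtx

/-- The premises of Rule (a) with conclusion `F`: results of replacing a positive
surface occurrence of a ⊓-subformula, or a negative surface occurrence of a
⊔-subformula, by one of its components. -/
def PremiseA (F H : CL2) : Prop :=
  ∃ (C : SCtx) (Gs : List CL2) (i : Fin Gs.length),
    (Even C.negCount ∧ F = C.fill (CL2.chand Gs) ∧ H = C.fill (Gs.get i)) ∨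
    (Odd C.negCount ∧ F = C.fill (CL2.chor Gs) ∧ H = C.fill (Gs.get i))

/-- The premise of Rule (b): `H` results from replacing in `F` a negative surface
occurrence of a ⊓-subformula, or a positive surface occurrence of a ⊔-subformula,
by one of its components. -/
def PremiseB (F H : CL2) : Prop :=
  ∃ (C : SCtx) (Gs : List CL2) (i : Fin Gs.length),
    (Odd C.negCount ∧ F = C.fill (CL2.chand Gs) ∧ H = C.fill (Gs.get i)) ∨
    (Even C.negCount ∧ F = C.fill (CL2.chor Gs) ∧ H = C.fill (Gs.get i))

/-- The premise of Rule (c): `H` results from replacing in `F` two — one positive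
and one negative — surface occurrences of a general atom by an elementary atom
not occurring in `F`. -/
def PremiseC (F H : CL2) : Prop :=
  ∃ (D : DCtx) (P p : Nat),
    F = D.fill2 (CL2.gen P) (CL2.gen P) ∧
    H = D.fill2 (CL2.elem p) (CL2.elem p) ∧
    ((Even D.negCount1 ∧ Odd D.negCount2) ∨ (Odd D.negCount1 ∧ Even D.negCount2)) ∧
    CL2.elemOccurs p F = false

/-- CL2-provability. -/
inductive Provable : CL2 → Prop where
  | ruleA (F : CL2) : CL2.Stable F → (∀ H, PremiseA F H → Provable H) → Provable F
  | ruleB (F H : CL2) : PremiseB F H → Provable H → Provable F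
  | ruleC (F H : CL2) : PremiseC F H → Provable H → Provable F

/-- Implication: F → G abbreviates ¬F ∨ G. -/
def CL2.imp (F G : CL2) : CL2 := CL2.lor [CL2.neg F, G]

/-- `conjImp [F₁,…,Fₙ] T` is F₁∧…∧Fₙ → T, with the conventions that for n = 1 it
is F₁ → T and for n = 0 it is T. -/
def conjImp (l : List CL2) (t : CL2) : CL2 :=
  match l with
  | [] => t
  | [f] => CL2.imp f t
  | l => CL2.imp (CL2.land l) t

/-- `conj1 [F₁,…,Fₙ]` is F₁∧…∧Fₙ, with the convention that for n = 1 it is F₁. -/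
def conj1 (l : List CL2) : CL2 :=
  match l with
  | [f] => f
  | l => CL2.land l

namespace CL2

theorem eval_land (v : Nat → Bool) (l : List CL2) : eval v (land l) = l.all (eval v) := by
  simp [eval]

theorem eval_lor (v : Nat → Bool) (l : List CL2) : eval v (lor l) = l.any (eval v) := by
  simp [eval]

theorem elemOccurs_land (p : Nat) (l : List CL2) :
    elemOccurs p (land l) = l.any (elemOccurs p) := by
  simp [elemOccurs]

theorem elemOccurs_lor (p : Nat) (l : List CL2) :
    elemOccurs p (lor l) = l.any (elemOccurs p) := by
  simp [elemOccurs]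

theorem eval_imp (v : Nat → Bool) (F G : CL2) : eval v (imp F G) = (!eval v F || eval v G) := by
  simp [imp, eval_lor, eval]

theorem elemOccurs_imp (p : Nat) (F G : CL2) :
    elemOccurs p (imp F G) = (elemOccurs p F || elemOccurs p G) := by
  simp [imp, elemOccurs_lor, elemOccurs]

/-- Formulas built from elementary atoms by `¬`, `∧` and `∨`. -/
inductive Elementary : CL2 → Prop where
  | elem (n : Nat) : Elementary (elem n)
  | neg {F : CL2} : Elementary F → Elementary (neg F)
  | land {l : List CL2} : (∀ F ∈ l, Elementary F) → Elementary (land l)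
  | lor {l : List CL2} : (∀ F ∈ l, Elementary F) → Elementary (lor l)

namespace Elementary

theorem elz_eq {F : CL2} (hF : Elementary F) (b : Bool) : elz b F = F := by
  induction hF generalizing b with
  | elem n => simp [elz]
  | neg _ ih => simp [elz, ih]
  | @land l _ ih =>
    have h : l.map (elz b) = l := by
      simpa using List.map_congr_left (g := id) fun F hF => ih F hF b
    simpa [elz] using h
  | @lor l _ ih =>
    have h : l.map (elz b) = l := by
      simpa using List.map_congr_left (g := id) fun F hF => ih F hF b
    simpa [elz] using h

theorem of_fill {C : SCtx} {G : CL2} (h : Elementary (C.fill G)) : Elementary G := by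
  induction C with
  | hole => exact h
  | neg C ih => cases h with | neg h => exact ih h
  | land l C r ih => cases h with | land h => exact ih (h _ (by simp))
  | lor l C r ih => cases h with | lor h => exact ih (h _ (by simp))

theorem imp {F G : CL2} (hF : Elementary F) (hG : Elementary G) : Elementary (F.imp G) :=
  .lor (by simpa using ⟨hF.neg, hG⟩)

/-- Elementary tautologies are provable. -/
theorem provable {F : CL2} (hF : Elementary F) (hv : ∀ v, eval v F = true) : Provable F := by
  refine .ruleA F (fun v => by rw [hF.elz_eq]; exact hv v) ?_
  rintro H ⟨C, Gs, i, ⟨-, rfl, -⟩ | ⟨-, rfl, -⟩⟩ <;> cases hF.of_fill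

end Elementary

end CL2

open CL2

theorem eval_conjImp (v : Nat → Bool) (L : List CL2) (t : CL2) :
    eval v (conjImp L t) = (!L.all (eval v) || eval v t) := by
  match L with
  | [] => simp [conjImp]
  | [f] => simp [conjImp, eval_imp]
  | f :: g :: L => simp [conjImp, eval_imp, eval_land]

theorem elemOccurs_conjImp (p : Nat) (L : List CL2) (t : CL2) :
    elemOccurs p (conjImp L t) = (L.any (elemOccurs p) || elemOccurs p t) := by
  match L with
  | [] => simp [conjImp]
  | [f] => simp [conjImp, elemOccurs_imp]
  | f :: g :: L => simp [conjImp, elemOccurs_imp, elemOccurs_land]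

theorem CL2.Elementary.conjImp {L : List CL2} {t : CL2} (hL : ∀ F ∈ L, Elementary F)
    (ht : Elementary t) : Elementary (conjImp L t) := by
  match L, hL with
  | [], _ => exact ht
  | [f], hL => exact .imp (hL f (by simp)) ht
  | f :: g :: L, hL => exact .imp (.land hL) ht

/-- The succedent of `conjImp L t` is a positive surface occurrence. -/
theorem exists_ctx_conjImp_right (L : List CL2) :
    ∃ C : SCtx, C.negCount = 0 ∧ ∀ t, C.fill t = conjImp L t := by
  match L with
  | [] => exact ⟨.hole, rfl, fun _ => rfl⟩
  | [f] => exact ⟨.lor [neg f] .hole [], rfl, fun _ => rfl⟩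
  | f :: g :: L => exact ⟨.lor [neg (land (f :: g :: L))] .hole [], rfl, fun _ => rfl⟩

/-- Every antecedent of `conjImp L t` is a negative surface occurrence. -/
theorem exists_ctx_conjImp_left (K L : List CL2) (t : CL2) :
    ∃ C : SCtx, C.negCount = 1 ∧ ∀ x, C.fill x = conjImp (K ++ x :: L) t := by
  match K, L with
  | [], [] => exact ⟨.lor [] (.neg .hole) [t], rfl, fun _ => rfl⟩
  | [], g :: L => exact ⟨.lor [] (.neg (.land [] .hole (g :: L))) [t], rfl, fun _ => rfl⟩
  | [f], L => exact ⟨.lor [] (.neg (.land [f] .hole L)) [t], rfl, fun _ => rfl⟩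
  | f :: g :: K, L =>
    exact ⟨.lor [] (.neg (.land (f :: g :: K) .hole L)) [t], rfl, fun _ => rfl⟩

/-- The formula `(X → (Y → Z)) ∧ (⋀ L → Y) → (X → (⋀ L → Z))`. -/
def cutFormula (X Y Z : CL2) (L : List CL2) : CL2 :=
  imp (land [imp X (imp Y Z), conjImp L Y]) (imp X (conjImp L Z))

theorem elemOccurs_cutFormula (p : Nat) (X Y Z : CL2) (L : List CL2) :
    elemOccurs p (cutFormula X Y Z L) =
      (elemOccurs p X || elemOccurs p Y || elemOccurs p Z || L.any (elemOccurs p)) := by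
  simp only [cutFormula, elemOccurs_imp, elemOccurs_land, elemOccurs_conjImp, List.any_cons,
    List.any_nil]
  grind

/-- Cut formulas over elementary atoms are provable. -/
theorem provable_cutFormula_elem (x y z : Nat) (es : List Nat) :
    Provable (cutFormula (elem x) (elem y) (elem z) (es.map elem)) := by
  have hes : ∀ F ∈ es.map elem, Elementary F := by
    simpa using fun n _ => Elementary.elem n
  refine Elementary.provable (.imp (.land ?_) ?_) fun v => ?_
  · simpa using ⟨Elementary.imp (.elem x) (.imp (.elem y) (.elem z)), .conjImp hes (.elem y)⟩
  · exact .imp (.elem x) (.conjImp hes (.elem z))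
  · simp only [cutFormula, eval_imp, eval_land, eval_conjImp, List.all_cons, List.all_nil]
    grind

theorem Provable.cutFormula_antecedent {X Y Z : CL2} {K L : List CL2} {p : Nat} (r : Nat)
    (hp : elemOccurs p (cutFormula X Y Z (K ++ gen r :: L)) = false)
    (h : Provable (cutFormula X Y Z (K ++ elem p :: L))) :
    Provable (cutFormula X Y Z (K ++ gen r :: L)) := by
  obtain ⟨C, hC, hCf⟩ := exists_ctx_conjImp_left K L Y
  obtain ⟨D, hD, hDf⟩ := exists_ctx_conjImp_left K L Z
  refine .ruleC _ _ ⟨.lorS [] (.neg (.land [imp X (imp Y Z)] C [])) []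
    (.lor [neg X] D []) [], r, p, ?_, ?_, ?_, hp⟩ h
  · simp [DCtx.fill2, SCtx.fill, hCf, hDf, cutFormula, imp]
  · simp [DCtx.fill2, SCtx.fill, hCf, hDf, cutFormula, imp]
  · simp [DCtx.negCount1, DCtx.negCount2, SCtx.negCount, hC, hD]

theorem Provable.cutFormula_fst {Y Z : CL2} {L : List CL2} {p : Nat} (P : Nat)
    (hp : elemOccurs p (cutFormula (gen P) Y Z L) = false)
    (h : Provable (cutFormula (elem p) Y Z L)) : Provable (cutFormula (gen P) Y Z L) :=
  .ruleC _ _ ⟨.lorS [] (.neg (.land [] (.lor [] (.neg .hole) [imp Y Z]) [conjImp L Y])) []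
    (.lor [] (.neg .hole) [conjImp L Z]) [], P, p, rfl, rfl,
    by simp [DCtx.negCount1, DCtx.negCount2, SCtx.negCount], hp⟩ h

theorem Provable.cutFormula_snd {X Z : CL2} {L : List CL2} {p : Nat} (Q : Nat)
    (hp : elemOccurs p (cutFormula X (gen Q) Z L) = false)
    (h : Provable (cutFormula X (elem p) Z L)) : Provable (cutFormula X (gen Q) Z L) := by
  obtain ⟨C, hC, hCf⟩ := exists_ctx_conjImp_right L
  refine .ruleC _ _ ⟨.lor [] (.neg (.landS [] (.lor [neg X] (.lor [] (.neg .hole) [Z]) []) []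
    C [])) [imp X (conjImp L Z)], Q, p, ?_, ?_, ?_, hp⟩ h
  · simp [DCtx.fill2, SCtx.fill, hCf, cutFormula, imp]
  · simp [DCtx.fill2, SCtx.fill, hCf, cutFormula, imp]
  · simp [DCtx.negCount1, DCtx.negCount2, SCtx.negCount, hC]

theorem Provable.cutFormula_thd {X Y : CL2} {L : List CL2} {p : Nat} (T : Nat)
    (hp : elemOccurs p (cutFormula X Y (gen T) L) = false)
    (h : Provable (cutFormula X Y (elem p) L)) : Provable (cutFormula X Y (gen T) L) := by
  obtain ⟨C, hC, hCf⟩ := exists_ctx_conjImp_right L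
  refine .ruleC _ _ ⟨.lorS [] (.neg (.land [] (.lor [neg X] (.lor [neg Y] .hole []) [])
    [conjImp L Y])) [] (.lor [neg X] C []) [], T, p, ?_, ?_, ?_, hp⟩ h
  · simp [DCtx.fill2, SCtx.fill, hCf, cutFormula, imp]
  · simp [DCtx.fill2, SCtx.fill, hCf, cutFormula, imp]
  · simp [DCtx.negCount1, DCtx.negCount2, SCtx.negCount, hC]

/-- Cut formulas whose antecedents are elementary atoms followed by general atoms are provable. -/
theorem provable_cutFormula_elem_append_gen (x y z : Nat) (es gs : List Nat) :
    Provable (cutFormula (elem x) (elem y) (elem z) (es.map elem ++ gs.map gen)) := by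
  induction gs generalizing es with
  | nil => simpa using provable_cutFormula_elem x y z es
  | cons r gs ih =>
    obtain ⟨p, hp⟩ := Infinite.exists_notMem_finset (x :: y :: z :: es).toFinset
    refine .cutFormula_antecedent (p := p) r ?_ (by simpa using ih (es ++ [p]))
    simp only [List.mem_toFinset, List.mem_cons] at hp
    simp only [elemOccurs_cutFormula, elemOccurs, List.any_append, List.any_map, List.any_cons,
      Function.comp_def]
    grind

/-- Lemma 8(e): for all m ≥ 0 and pairwise distinct general atoms P, Q, T, R₁,…,R_m,
the formula (P → (Q → T)) ∧ (R₁∧…∧R_m → Q) → (P → (R₁∧…∧R_m → T)) is provable in CL2. -/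
theorem cl2_provable_e (m : Nat) (P Q T : Nat) (R : Fin m → Nat)
    (hdist : (P :: Q :: T :: List.ofFn R).Nodup) :
    Provable (CL2.imp
      (CL2.land [CL2.imp (CL2.gen P) (CL2.imp (CL2.gen Q) (CL2.gen T)),
                 conjImp ((List.ofFn R).map CL2.gen) (CL2.gen Q)])
      (CL2.imp (CL2.gen P) (conjImp ((List.ofFn R).map CL2.gen) (CL2.gen T)))) := by
  have hgen (p : Nat) : ((List.ofFn R).map gen).any (elemOccurs p) = false := by
    simp [elemOccurs]
  refine .cutFormula_fst (p := 0) P (by simp only [elemOccurs_cutFormula, hgen, elemOccurs]; rfl) ?_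
  refine .cutFormula_snd (p := 1) Q (by simp only [elemOccurs_cutFormula, hgen, elemOccurs]; rfl) ?_
  refine .cutFormula_thd (p := 2) T (by simp only [elemOccurs_cutFormula, hgen, elemOccurs]; rfl) ?_
  exact provable_cutFormula_elem_append_gen 0 1 2 [] (List.ofFn R)
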